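/- Let 𝓒 = {C_x : x ∈ M^l} be a directed definable family of subsets of M^k. If the union ⋃_{x ∈ M^l} C_x has non-empty interior, then some member C_x of 𝓒 has non-empty interior. -/

import Mathlib

/-! Common framework: dp-minimal structures with a definable uniform structure,
following "Dp-minimal structures equipped with definable uniformities". -/

namespace DpTame

open FirstOrder Set Cardinal

universe u

variable (L : FirstOrder.Language.{u, u}) (M : Type u) [L.Structure M]

/-- `A ⊆ M^α` is definable with parameters from `C ⊆ M`. -/
def DefSetP (C : Set M) {α : Type} (A : Set (α → M)) : Prop :=
  C.Definable L A

/-- `A ⊆ M^α` is definable (with parameters from `M`). -/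
def DefSet {α : Type} (A : Set (α → M)) : Prop :=
  (Set.univ : Set M).Definable L A

/-- A subset of `M` is definable (with parameters). -/
def DefSet1 (A : Set M) : Prop :=
  DefSet L M {v : Fin 1 → M | v 0 ∈ A}

/-- A definable relation between two tuple sorts, with parameters from `C`. -/
def DefRelP (C : Set M) {k l : ℕ} (G : Set ((Fin k → M) × (Fin l → M))) : Prop :=
  DefSetP L M C {v : (Fin k ⊕ Fin l) → M | (v ∘ Sum.inl, v ∘ Sum.inr) ∈ G}

/-- A definable relation between two tuple sorts, with parameters from `M`. -/
def DefRel {k l : ℕ} (G : Set ((Fin k → M) × (Fin l → M))) : Prop :=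
  DefRelP L M Set.univ G

/-- A definable subset of `M × M`. -/
def DefRel1 (G : Set (M × M)) : Prop :=
  DefSet L M {v : Fin 2 → M | (v 0, v 1) ∈ G}

/-- Model-theoretic algebraic closure of a parameter set `C ⊆ M`:
`a` lies in a finite `C`-definable set. -/
def aclOf (C : Set M) : Set M :=
  {a | ∃ S : Set (Fin 1 → M), C.Definable L S ∧ S.Finite ∧ (fun _ => a) ∈ S}

/-- The acl-dimension of a tuple over `C`: the minimal size of a subtuple over which (together
with `C`) the whole tuple is algebraic. -/
noncomputable def aclDimTuple (C : Set M) {k : ℕ} (a : Fin k → M) : ℕ :=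
  sInf {l | ∃ s : Finset (Fin k), s.card = l ∧ ∀ i, a i ∈ aclOf L M (C ∪ (a '' ↑s))}

open Classical in
/-- The acl-dimension of a set `A ⊆ M^k` defined over `C` (with `⊥` for the empty set). -/
noncomputable def aclDim (C : Set M) {k : ℕ} (A : Set (Fin k → M)) : WithBot ℕ :=
  if A = ∅ then ⊥ else ↑(sSup {l | ∃ a ∈ A, aclDimTuple L M C a = l})

/-- `A ⊆ M^k` has dp-rank greater than `n`: there are (definable-with-parameters) formulas
`φ_i(x,y)` for `i ≤ n` (coded as definable subsets of `M^k × M`) and infinite sets `B i ⊆ M`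
such that every choice from `∏ B i` is coded by an element of `A`. -/
def DpRankGt {k : ℕ} (A : Set (Fin k → M)) (n : ℕ) : Prop :=
  ∃ (Φ : Fin (n + 1) → Set ((Fin k ⊕ Fin 1) → M)) (B : Fin (n + 1) → Set M),
    (∀ i, DefSet L M (Φ i)) ∧ (∀ i, (B i).Infinite) ∧
    ∀ b : Fin (n + 1) → M, (∀ i, b i ∈ B i) →
      ∃ a ∈ A, ∀ i, ∀ y ∈ B i, (Sum.elim a (fun _ => y) ∈ Φ i ↔ y = b i)

open Classical in
/-- The dp-rank of a definable set, with `⊥` for the empty set. -/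
noncomputable def dpRank {k : ℕ} (A : Set (Fin k → M)) : WithBot ℕ :=
  if A = ∅ then ⊥ else ↑(sSup {m : ℕ | ∃ n, m = n + 1 ∧ DpRankGt L M A n})

/-- Dp-minimality (with respect to the home sort `M`): `M` does not have dp-rank greater
than one. -/
def DpMinimal : Prop :=
  ¬ DpRankGt L M (Set.univ : Set (Fin 1 → M)) 1

/-- `M` is NIP: no definable relation has the independence property. -/
def IsNIP : Prop :=
  ∀ (n m : ℕ) (Φ : Set ((Fin n ⊕ Fin m) → M)), DefSet L M Φ →
    ¬ ∃ (a : ℕ → Fin n → M) (b : Finset ℕ → Fin m → M),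
        ∀ (i : ℕ) (s : Finset ℕ), (Sum.elim (a i) (b s) ∈ Φ ↔ i ∈ s)

/-- Every finitely satisfiable collection of formulas in one variable over `C` is realized. -/
def RealizesTypesOver (C : Set M) : Prop :=
  ∀ p : Set ((L[[C]]).Formula (Fin 1)),
    (∀ s : Finset ((L[[C]]).Formula (Fin 1)), ↑s ⊆ p →
      ∃ a : M, ∀ φ ∈ s, φ.Realize (fun _ => a)) →
    ∃ a : M, ∀ φ ∈ p, φ.Realize (fun _ => a)

/-- `M` is `|L|⁺`-saturated. -/
def IsLPlusSaturated : Prop :=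
  ∀ C : Set M, #C ≤ L.card + ℵ₀ → RealizesTypesOver L M C

/-- Two tuples have the same type over `C`. -/
def SameTypeOver (C : Set M) {n : ℕ} (a b : Fin n → M) : Prop :=
  ∀ φ : (L[[C]]).Formula (Fin n), φ.Realize a ↔ φ.Realize b

/-- A sequence indexed by `ℕ` is indiscernible over `C`. -/
def IndiscernibleOver (C : Set M) (I : ℕ → M) : Prop :=
  ∀ (n : ℕ) (f g : Fin n → ℕ), StrictMono f → StrictMono g →
    SameTypeOver L M C (I ∘ f) (I ∘ g)

/-- The sequences `I l` are mutually indiscernible over `C`: each is indiscernible over `C`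
together with all of the other sequences. -/
def MutuallyIndiscernibleOver (C : Set M) {k : ℕ} (I : Fin k → ℕ → M) : Prop :=
  ∀ l : Fin k,
    IndiscernibleOver L M (C ∪ ⋃ m ∈ ({m : Fin k | m ≠ l} : Set (Fin k)), Set.range (I m)) (I l)

/-- A correspondence with domain `E ⊆ M^k`, values in `M^l`, definable over `C`: a definable
graph all of whose fibers over points of `E` are finite and nonempty. -/
def IsCorrP (C : Set M) {k l : ℕ} (E : Set (Fin k → M))
    (G : Set ((Fin k → M) × (Fin l → M))) : Prop :=
  DefRelP L M C G ∧ (∀ p ∈ G, p.1 ∈ E) ∧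
    ∀ x ∈ E, {y | (x, y) ∈ G}.Nonempty ∧ {y | (x, y) ∈ G}.Finite

/-- A correspondence, definable with arbitrary parameters. -/
def IsCorr {k l : ℕ} (E : Set (Fin k → M)) (G : Set ((Fin k → M) × (Fin l → M))) : Prop :=
  IsCorrP L M Set.univ E G

/-- An `m`-correspondence: every fiber has exactly `m` elements. -/
def IsMCorrP (C : Set M) {k l : ℕ} (E : Set (Fin k → M))
    (G : Set ((Fin k → M) × (Fin l → M))) (m : ℕ) : Prop :=
  IsCorrP L M C E G ∧ ∀ x ∈ E, {y | (x, y) ∈ G}.ncard = m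

/-- An `m`-correspondence definable with arbitrary parameters. -/
def IsMCorr {k l : ℕ} (E : Set (Fin k → M)) (G : Set ((Fin k → M) × (Fin l → M)))
    (m : ℕ) : Prop :=
  IsMCorrP L M Set.univ E G m

/-- A definable uniform structure on `M`: a definable basis of entourages
`{φ(M², c̄) : c̄ ∈ dom}` satisfying the axioms for a basis of a (Hausdorff) uniformity. -/
structure DefUniformBasis where
  n : ℕ
  dom : Set (Fin n → M)
  dom_nonempty : dom.Nonempty
  dom_def : DefSet L M dom
  phi : Set ((Fin 2 ⊕ Fin n) → M)
  phi_def : DefSet L M phi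
  symm : ∀ c ∈ dom, ∀ x y : M, Sum.elim ![x, y] c ∈ phi → Sum.elim ![y, x] c ∈ phi
  inter_eq_diag : ∀ x y : M, (∀ c ∈ dom, Sum.elim ![x, y] c ∈ phi) ↔ x = y
  directed : ∀ c ∈ dom, ∀ d ∈ dom, ∃ e ∈ dom, ∀ x y : M,
    Sum.elim ![x, y] e ∈ phi → Sum.elim ![x, y] c ∈ phi ∧ Sum.elim ![x, y] d ∈ phi
  comp : ∀ c ∈ dom, ∃ d ∈ dom, ∀ x y z : M,
    Sum.elim ![x, y] d ∈ phi → Sum.elim ![y, z] d ∈ phi → Sum.elim ![x, z] c ∈ phi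

namespace DefUniformBasis

variable {L M} (U : DefUniformBasis L M)

/-- The entourage with parameter `c`. -/
def ent (c : Fin U.n → M) : Set (M × M) :=
  {p | Sum.elim ![p.1, p.2] c ∈ U.phi}

/-- The ball of radius `c` around `x ∈ M`. -/
def ball (c : Fin U.n → M) (x : M) : Set M :=
  {y | (x, y) ∈ U.ent c}

/-- The ball of radius `c` around `x ∈ M^k` (product uniformity). -/
def ballk {k : ℕ} (c : Fin U.n → M) (x : Fin k → M) : Set (Fin k → M) :=
  {y | ∀ i, (x i, y i) ∈ U.ent c}

/-- Openness in `M` for the topology induced by the uniform structure. -/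
def IsOpen1 (A : Set M) : Prop :=
  ∀ x ∈ A, ∃ c ∈ U.dom, U.ball c x ⊆ A

/-- Interior in `M`. -/
def interior1 (A : Set M) : Set M :=
  {x | ∃ c ∈ U.dom, U.ball c x ⊆ A}

/-- Closure in `M`. -/
def closure1 (A : Set M) : Set M :=
  {x | ∀ c ∈ U.dom, (U.ball c x ∩ A).Nonempty}

/-- Openness in `M^k` for the product topology. -/
def IsOpenk {k : ℕ} (A : Set (Fin k → M)) : Prop :=
  ∀ x ∈ A, ∃ c ∈ U.dom, U.ballk c x ⊆ A

/-- Interior in `M^k`. -/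
def interiork {k : ℕ} (A : Set (Fin k → M)) : Set (Fin k → M) :=
  {x | ∃ c ∈ U.dom, U.ballk c x ⊆ A}

/-- Closure in `M^k`. -/
def closurek {k : ℕ} (A : Set (Fin k → M)) : Set (Fin k → M) :=
  {x | ∀ c ∈ U.dom, (U.ballk c x ∩ A).Nonempty}

/-- The frontier `∂A = cl(A) ∖ A`. -/
def frontierk {k : ℕ} (A : Set (Fin k → M)) : Set (Fin k → M) :=
  U.closurek A \ A

/-- Closedness in `M^k`. -/
def IsClosedk {k : ℕ} (A : Set (Fin k → M)) : Prop :=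
  U.closurek A ⊆ A

/-- `B` is dense in `A`. -/
def DenseIn {k : ℕ} (B A : Set (Fin k → M)) : Prop :=
  A ⊆ U.closurek B

/-- `A ⊆ M^k` is locally closed: every point of `A` has a (ball) neighborhood `W` such that
`A ∩ W` is closed in `W`. -/
def IsLocallyClosedk {k : ℕ} (A : Set (Fin k → M)) : Prop :=
  ∀ x ∈ A, ∃ c ∈ U.dom, U.ballk c x ∩ U.closurek (A ∩ U.ballk c x) ⊆ A

open Classical in
/-- The naive topological dimension of `A ⊆ M^k`: the largest `l` such that some coordinate
projection of `A` to `M^l` has nonempty interior (`⊥` for the empty set). -/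
noncomputable def topDim {k : ℕ} (A : Set (Fin k → M)) : WithBot ℕ :=
  if A = ∅ then ⊥ else
    ↑(sSup {l : ℕ | ∃ σ : Fin l → Fin k, Function.Injective σ ∧
        (U.interiork ((fun v => v ∘ σ) '' A)).Nonempty})

/-- Continuity of a correspondence with domain `E` and graph `G` at a point `x ∈ E`. -/
def CorrContAt {k l : ℕ} (E : Set (Fin k → M)) (G : Set ((Fin k → M) × (Fin l → M)))
    (x : Fin k → M) : Prop :=
  ∀ c ∈ U.dom, ∃ d ∈ U.dom, ∀ x' ∈ E, x' ∈ U.ballk d x →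
    (∀ y, (x, y) ∈ G → ∃ y', (x', y') ∈ G ∧ ∀ j, (y j, y' j) ∈ U.ent c) ∧
    (∀ y', (x', y') ∈ G → ∃ y, (x, y) ∈ G ∧ ∀ j, (y j, y' j) ∈ U.ent c)

/-- Continuity of a correspondence at every point of its domain. -/
def CorrContOn {k l : ℕ} (E : Set (Fin k → M)) (G : Set ((Fin k → M) × (Fin l → M))) : Prop :=
  ∀ x ∈ E, U.CorrContAt E G x

/-- Continuity of a function `M^k → M^l` on a set `V` (relative topology). -/
def ContOn {k l : ℕ} (f : (Fin k → M) → (Fin l → M)) (V : Set (Fin k → M)) : Prop :=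
  ∀ x ∈ V, ∀ c ∈ U.dom, ∃ d ∈ U.dom, ∀ y ∈ V, y ∈ U.ballk d x → f y ∈ U.ballk c (f x)

/-- `f` restricted to `V` is a homeomorphism onto its image. -/
def HomeoOnto {k l : ℕ} (f : (Fin k → M) → (Fin l → M)) (V : Set (Fin k → M)) : Prop :=
  Set.InjOn f V ∧ U.ContOn f V ∧
    ∀ x ∈ V, ∀ c ∈ U.dom, ∃ d ∈ U.dom, ∀ y ∈ V, f y ∈ U.ballk d (f x) → y ∈ U.ballk c x

/-- Continuity of a function `M → M` on a set `V`. -/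
def Cont1On (f : M → M) (V : Set M) : Prop :=
  ∀ x ∈ V, ∀ c ∈ U.dom, ∃ d ∈ U.dom, ∀ y ∈ V, y ∈ U.ball d x → f y ∈ U.ball c (f x)

/-- `f : M → M` restricted to `V` is a homeomorphism onto its image. -/
def Homeo1Onto (f : M → M) (V : Set M) : Prop :=
  Set.InjOn f V ∧ U.Cont1On f V ∧
    ∀ x ∈ V, ∀ c ∈ U.dom, ∃ d ∈ U.dom, ∀ y ∈ V, f y ∈ U.ball d (f x) → y ∈ U.ball c x

end DefUniformBasis

/-- The standing assumptions of the paper: `M` is an infinite `|L|⁺`-saturated NIP dp-minimal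
structure carrying a definable uniform structure whose topology has no isolated points and in
which every infinite definable subset of `M` has nonempty interior (Inf). -/
structure Setting extends DefUniformBasis L M where
  nonempty : Nonempty M
  saturated : IsLPlusSaturated L M
  nip : IsNIP L M
  dpMin : DpMinimal L M
  noIsolated : ∀ x : M, ∀ c ∈ toDefUniformBasis.dom, ∃ y, y ≠ x ∧
    y ∈ toDefUniformBasis.ball c x
  infInterior : ∀ A : Set M, DefSet1 L M A → A.Infinite →
    (toDefUniformBasis.interior1 A).Nonempty

end DpTame

namespace DpTame

open FirstOrder Set Cardinal

universe u

variable {L : FirstOrder.Language.{u, u}} {M : Type u} [L.Structure M]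

/-! ### Definability with parameters -/

/-- A map `M^α → M` that is a coordinate projection or a constant. -/
def IsCoordOrConst {α : Type} (t : (α → M) → M) : Prop :=
  (∃ j, t = fun v => v j) ∨ ∃ c, t = fun _ => c

lemma isCoordOrConst_coord {α : Type} (j : α) : IsCoordOrConst (fun v : α → M => v j) :=
  Or.inl ⟨j, rfl⟩

lemma isCoordOrConst_const {α : Type} (c : M) : IsCoordOrConst (fun _ : α → M => c) :=
  Or.inr ⟨c, rfl⟩

lemma DefSet.subst {α β : Type} {s : Set (β → M)} (hs : DefSet L M s)
    {t : β → (α → M) → M} (ht : ∀ i, IsCoordOrConst (t i)) :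
    DefSet L M {v : α → M | (fun i => t i v) ∈ s} := by
  obtain ⟨φ, rfl⟩ := hs
  have h : ∀ i, ∃ τ : (L[[(Set.univ : Set M)]]).Term α, ∀ v, τ.realize v = t i v := by
    intro i
    rcases ht i with ⟨j, hj⟩ | ⟨c, hc⟩
    · exact ⟨Language.Term.var j, fun v => by simp [hj]⟩
    · exact ⟨(L.con (⟨c, Set.mem_univ c⟩ : (Set.univ : Set M))).term, fun v => by simp [hc]⟩
  choose τ hτ using h
  refine ⟨Language.BoundedFormula.subst φ τ, ?_⟩
  ext v
  have : (fun i => t i v) = fun i => (τ i).realize v := funext fun i => (hτ i v).symm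
  simp only [Set.mem_ofPred_eq, this]
  exact (Language.BoundedFormula.realize_subst (φ := φ)).symm

lemma DefSet.reindex {α β : Type} {s : Set (β → M)} (hs : DefSet L M s) (f : β → α) :
    DefSet L M {v : α → M | v ∘ f ∈ s} :=
  Definable.preimage_comp f hs

lemma DefSet.and {α : Type} {P Q : (α → M) → Prop} (hP : DefSet L M {v | P v})
    (hQ : DefSet L M {v | Q v}) : DefSet L M {v | P v ∧ Q v} :=
  Definable.inter hP hQ

lemma DefSet.not {α : Type} {P : (α → M) → Prop} (hP : DefSet L M {v | P v}) :
    DefSet L M {v | ¬ P v} :=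
  Definable.compl hP

lemma DefSet.imp {α : Type} {P Q : (α → M) → Prop} (hP : DefSet L M {v | P v})
    (hQ : DefSet L M {v | Q v}) : DefSet L M {v | P v → Q v} := by
  have h := (hP.and hQ.not).not
  simpa only [not_and, not_not] using h

lemma DefSet.forall_finite {α ι : Type} [Finite ι] {P : ι → (α → M) → Prop}
    (hP : ∀ i, DefSet L M {v | P i v}) : DefSet L M {v | ∀ i, P i v} := by
  have h : DefSet L M (⋂ i, {v | P i v}) := definable_iInter_of_finite hP
  rwa [← Set.ofPred_forall] at h

lemma DefSet.prop {α : Type} (p : Prop) : DefSet L M {_v : α → M | p} := by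
  by_cases hp : p
  · simp only [hp]
    exact definable_univ
  · simp only [hp]
    exact definable_empty

lemma DefSet.eq_coord {α : Type} (i j : α) : DefSet L M {v : α → M | v i = v j} :=
  ⟨(Language.Term.var i).equal (Language.Term.var j), by ext v; simp⟩

lemma DefSet.exists_tuple {α β : Type} [Finite β] {P : (α → M) → (β → M) → Prop}
    (hP : DefSet L M {w : α ⊕ β → M | P (w ∘ Sum.inl) (w ∘ Sum.inr)}) :
    DefSet L M {v | ∃ y, P v y} := by
  have h := Definable.exists_of_finite hP
  simpa [DefSet] using h

lemma DefSet.forall_tuple {α β : Type} [Finite β] {P : (α → M) → (β → M) → Prop}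
    (hP : DefSet L M {w : α ⊕ β → M | P (w ∘ Sum.inl) (w ∘ Sum.inr)}) :
    DefSet L M {v | ∀ y, P v y} := by
  have h := Definable.forall_of_finite hP
  simpa [DefSet] using h

/-! ### Saturation for decreasing sequences of definable sets -/

lemma IsLPlusSaturated.exists_mem_of_antitone₁ (hsat : IsLPlusSaturated L M)
    (X : ℕ → Set M) (hdef : ∀ n, DefSet1 L M (X n)) (hanti : Antitone X)
    (hne : ∀ n, (X n).Nonempty) : ∃ a, ∀ n, a ∈ X n := by
  choose A₀ _ hA₀ using fun n => definable_iff_finitely_definable.1 (hdef n)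
  let C : Set M := ⋃ n, (A₀ n : Set M)
  have hC : C.Countable := Set.countable_iUnion fun n => (A₀ n).countable_toSet
  have hφ : ∀ n, C.Definable L {v : Fin 1 → M | v 0 ∈ X n} := fun n =>
    (hA₀ n).mono (Set.subset_iUnion (fun n => (A₀ n : Set M)) n)
  choose φ hφ using hφ
  have key : ∀ n a, (φ n).Realize (fun _ => a) ↔ a ∈ X n := by
    intro n a
    have := Set.ext_iff.1 (hφ n) (fun _ => a)
    simpa using this.symm
  obtain ⟨a, ha⟩ := hsat C ((mk_le_aleph0_iff.2 hC).trans (self_le_add_left _ _))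
    (Set.range φ) (by
      intro s hs
      choose! g hg using hs
      obtain ⟨a, ha⟩ := hne (s.sup g)
      refine ⟨a, fun ψ hψ => ?_⟩
      rw [← hg hψ]
      exact (key _ a).2 (hanti (Finset.le_sup hψ) ha))
  exact ⟨a, fun n => (key n a).1 (ha _ ⟨n, rfl⟩)⟩

lemma IsLPlusSaturated.exists_mem_of_antitone (hsat : IsLPlusSaturated L M) {l : ℕ}
    (X : ℕ → Set (Fin l → M)) (hdef : ∀ n, DefSet L M (X n)) (hanti : Antitone X)
    (hne : ∀ n, (X n).Nonempty) : ∃ a, ∀ n, a ∈ X n := by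
  induction l with
  | zero =>
    obtain ⟨a, -⟩ := hne 0
    refine ⟨a, fun n => ?_⟩
    obtain ⟨b, hb⟩ := hne n
    rwa [Subsingleton.elim a b]
  | succ l ih =>
    obtain ⟨m, hm⟩ := hsat.exists_mem_of_antitone₁
      (fun n => {m | ∃ v : Fin l → M, (Fin.cons m v : Fin (l + 1) → M) ∈ X n})
      (fun n => by
        refine DefSet.exists_tuple (α := Fin 1) (β := Fin l)
          (P := fun u v => (Fin.cons (u 0) v : Fin (l + 1) → M) ∈ X n) ?_
        have h := (hdef n).reindex
          (Fin.cons (Sum.inl 0) Sum.inr : Fin (l + 1) → Fin 1 ⊕ Fin l)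
        simpa only [Fin.comp_cons, Function.comp_apply] using h)
      (fun n n' h m ⟨v, hv⟩ => ⟨v, hanti h hv⟩)
      (fun n => by
        obtain ⟨a, ha⟩ := hne n
        exact ⟨a 0, Fin.tail a, by rwa [Fin.cons_self_tail]⟩)
    obtain ⟨v, hv⟩ := ih (fun n => {v | (Fin.cons m v : Fin (l + 1) → M) ∈ X n})
      (fun n => by
        have h := (hdef n).subst (α := Fin l)
          (t := fun i v => (Fin.cons m v : Fin (l + 1) → M) i)
          (fun i => by
            refine Fin.cases ?_ (fun i => ?_) i
            · exact isCoordOrConst_const m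
            · exact isCoordOrConst_coord i)
        exact h)
      (fun n n' h v hv => hanti h hv) hm
    exact ⟨_, hv⟩

/-! ### Finite grids -/

/-- `A ⊆ X^k` contains a product of `k` sets with `n` elements each. -/
def HasGrid {X : Type*} (n : ℕ) : {k : ℕ} → Set (Fin k → X) → Prop
  | 0, A => A.Nonempty
  | _ + 1, A => ∃ s : Fin n → X, Function.Injective s ∧
      HasGrid n {a | ∀ j, (Fin.cons (s j) a : Fin (_ + 1) → X) ∈ A}

section Grid

variable {X : Type*}

lemma HasGrid.mono {n m : ℕ} (hmn : m ≤ n) {k : ℕ} {A B : Set (Fin k → X)}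
    (h : HasGrid n A) (hAB : A ⊆ B) : HasGrid m B := by
  induction k with
  | zero => exact Set.Nonempty.mono hAB h
  | succ k ih =>
    obtain ⟨s, hs, h⟩ := h
    exact ⟨s ∘ Fin.castLE hmn, hs.comp (Fin.castLE_injective hmn),
      ih h fun a ha j => hAB (ha _)⟩

lemma HasGrid.nonempty {n : ℕ} (hn : 0 < n) {k : ℕ} {A : Set (Fin k → X)}
    (h : HasGrid n A) : A.Nonempty := by
  induction k with
  | zero => exact h
  | succ k ih =>
    obtain ⟨s, -, h⟩ := h
    obtain ⟨a, ha⟩ := ih h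
    exact ⟨_, ha ⟨0, hn⟩⟩

/-- A product Ramsey theorem: a finite colouring of a large grid has a large monochromatic
subgrid. -/
lemma exists_hasGrid_of_cover (k n : ℕ) (ι : Type) [Finite ι] :
    ∃ N, ∀ (A : Set (Fin k → X)) (B : ι → Set (Fin k → X)), (A ⊆ ⋃ i, B i) →
      HasGrid N A → ∃ i, HasGrid n (B i) := by
  classical
  induction k generalizing ι with
  | zero =>
    refine ⟨0, fun A B hAB ⟨a, ha⟩ => ?_⟩
    obtain ⟨i, hi⟩ := Set.mem_iUnion.1 (hAB ha)
    exact ⟨i, a, hi⟩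
  | succ k ih =>
    have := Fintype.ofFinite ι
    let N' := Fintype.card ι * n + 1
    obtain ⟨N, hN⟩ := ih (Fin N' → ι)
    refine ⟨max N N', fun A B hAB ⟨s, hs, h⟩ => ?_⟩
    let s' : Fin N' → X := s ∘ Fin.castLE (le_max_right N N')
    have hs' : Function.Injective s' := hs.comp (Fin.castLE_injective _)
    obtain ⟨g, hg⟩ := hN {a | ∀ j, (Fin.cons (s' j) a : Fin (k + 1) → X) ∈ A}
      (fun g => {a | ∀ j, (Fin.cons (s' j) a : Fin (k + 1) → X) ∈ B (g j)})
      (fun a ha => by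
        choose g hg using fun j => Set.mem_iUnion.1 (hAB (ha j))
        exact Set.mem_iUnion.2 ⟨g, hg⟩)
      (h.mono (le_max_left _ _) (fun a ha j => ha _))
    have : Nonempty ι := ⟨g 0⟩
    obtain ⟨i, hi⟩ := Fintype.exists_le_card_fiber_of_mul_le_card g (n := n)
      (by simp [N'])
    obtain ⟨t, ht, htn⟩ := Finset.exists_subset_card_eq hi
    let e := t.orderEmbOfFin htn
    refine ⟨i, s' ∘ e, hs'.comp e.injective, hg.mono le_rfl fun a ha j => ?_⟩
    have hj : g (e j) = i := (Finset.mem_filter.1 (ht (t.orderEmbOfFin_mem htn j))).2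
    have := ha (e j)
    rwa [hj] at this

lemma hasGrid_or_hasGrid_of_subset_union {k : ℕ} {A B C : Set (Fin k → X)} (hA : A ⊆ B ∪ C)
    (h : ∀ n, HasGrid n A) : (∀ n, HasGrid n B) ∨ ∀ n, HasGrid n C := by
  by_contra! hcon
  obtain ⟨⟨p, hp⟩, q, hq⟩ := hcon
  obtain ⟨N, hN⟩ := exists_hasGrid_of_cover (X := X) k (max p q) Bool
  obtain ⟨i, hi⟩ := hN A (fun i => cond i B C) (by rwa [← Set.union_eq_iUnion]) (h N)
  cases i
  · exact hq (hi.mono (le_max_right _ _) subset_rfl)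
  · exact hp (hi.mono (le_max_left _ _) subset_rfl)

lemma exists_hasGrid_of_directed {ι : Type*} [Nonempty ι] {n k : ℕ} {C : ι → Set (Fin k → X)}
    (hC : Directed (· ⊆ ·) C) (h : HasGrid n (⋃ i, C i)) : ∃ i, HasGrid n (C i) := by
  induction k with
  | zero =>
    obtain ⟨a, ha⟩ := h
    obtain ⟨i, hi⟩ := Set.mem_iUnion.1 ha
    exact ⟨i, a, hi⟩
  | succ k ih =>
    obtain ⟨s, hs, h⟩ := h
    obtain ⟨i, hi⟩ := ih (C := fun i => {a | ∀ j, (Fin.cons (s j) a : Fin (k + 1) → X) ∈ C i})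
      (fun i i' => by
        obtain ⟨z, hz, hz'⟩ := hC i i'
        exact ⟨z, fun a ha j => hz (ha j), fun a ha j => hz' (ha j)⟩)
      (h.mono le_rfl fun a ha => by
        choose g hg using fun j => Set.mem_iUnion.1 (ha j)
        obtain ⟨z, hz⟩ := hC.finite_le g
        exact Set.mem_iUnion.2 ⟨z, fun j => hz j (hg j)⟩)
    exact ⟨i, s, hs, hi⟩

lemma infinite_of_hasGrid_one {A : Set X}
    (h : ∀ n, HasGrid n {u : Fin 1 → X | u 0 ∈ A}) : A.Infinite := by
  intro hA
  obtain ⟨s, hs, a, ha⟩ := h (hA.toFinset.card + 1)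
  have := Finset.card_le_card_of_injOn s (s := Finset.univ) (t := hA.toFinset)
    (fun j _ => by simpa using ha j) hs.injOn
  simp at this

end Grid

lemma DefSet.hasGrid {α : Type} (n : ℕ) {k : ℕ} {P : (α → M) → (Fin k → M) → Prop}
    (hP : DefSet L M {w : α ⊕ Fin k → M | P (w ∘ Sum.inl) (w ∘ Sum.inr)}) :
    DefSet L M {v | HasGrid n {a | P v a}} := by
  induction k generalizing α with
  | zero => exact DefSet.exists_tuple hP
  | succ k ih =>
    refine DefSet.exists_tuple (P := fun v s => Function.Injective s ∧
      HasGrid n {a | ∀ j, P v (Fin.cons (s j) a)}) (DefSet.and ?_ ?_)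
    · refine DefSet.forall_finite fun i => DefSet.forall_finite fun j => DefSet.imp ?_ ?_
      · exact DefSet.eq_coord _ _
      · exact DefSet.prop _
    · refine ih (P := fun w a => ∀ j, P (w ∘ Sum.inl) (Fin.cons (w (Sum.inr j)) a))
        (DefSet.forall_finite fun j => ?_)
      have h := hP.reindex (Sum.elim (Sum.inl ∘ Sum.inl) (Fin.cons (Sum.inl (Sum.inr j)) Sum.inr) :
        α ⊕ Fin (k + 1) → (α ⊕ Fin n) ⊕ Fin k)
      simpa only [Set.mem_ofPred_eq, Function.comp_assoc, Sum.elim_comp_inl, Sum.elim_comp_inr,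
        Fin.comp_cons, Function.comp_apply] using h

lemma IsLPlusSaturated.exists_forall_hasGrid (hsat : IsLPlusSaturated L M) {l k : ℕ}
    {P : (Fin l → M) → (Fin k → M) → Prop}
    (hP : DefSet L M {w : Fin l ⊕ Fin k → M | P (w ∘ Sum.inl) (w ∘ Sum.inr)})
    (h : ∀ n, ∃ x, HasGrid n {p | P x p}) : ∃ x, ∀ n, HasGrid n {p | P x p} :=
  hsat.exists_mem_of_antitone (fun n => {x | HasGrid n {p | P x p}})
    (fun n => DefSet.hasGrid n hP) (fun _ _ hmn _ hx => hx.mono hmn subset_rfl) h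

lemma IsLPlusSaturated.exists_forall_hasGrid_of_directed (hsat : IsLPlusSaturated L M)
    {l k : ℕ} {P : (Fin l → M) → (Fin k → M) → Prop}
    (hP : DefSet L M {w : Fin l ⊕ Fin k → M | P (w ∘ Sum.inl) (w ∘ Sum.inr)})
    (hdir : ∀ x y, ∃ z, ∀ p, P x p ∨ P y p → P z p)
    (h : ∀ n, HasGrid n {p | ∃ x, P x p}) : ∃ x, ∀ n, HasGrid n {p | P x p} := by
  refine hsat.exists_forall_hasGrid hP fun n => ?_
  obtain ⟨p, x, -⟩ := (h 1).nonempty one_pos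
  have : Nonempty (Fin l → M) := ⟨x⟩
  refine exists_hasGrid_of_directed (C := fun x => {p | P x p}) (fun x y => ?_)
    (by simpa only [← Set.ofPred_exists] using h n)
  obtain ⟨z, hz⟩ := hdir x y
  exact ⟨z, fun p hp => hz p (Or.inl hp), fun p hp => hz p (Or.inr hp)⟩

/-! ### Grids and interior -/

namespace DefUniformBasis

variable (U : DefUniformBasis L M)

lemma refl_mem_ent {c : Fin U.n → M} (hc : c ∈ U.dom) (x : M) : (x, x) ∈ U.ent c :=
  (U.inter_eq_diag x x).2 rfl c hc

lemma mem_ballk_self {c : Fin U.n → M} (hc : c ∈ U.dom) {k : ℕ} (x : Fin k → M) :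
    x ∈ U.ballk c x :=
  fun i => U.refl_mem_ent hc (x i)

lemma exists_ent_subset_inter {c d : Fin U.n → M} (hc : c ∈ U.dom) (hd : d ∈ U.dom) :
    ∃ e ∈ U.dom, U.ent e ⊆ U.ent c ∩ U.ent d := by
  obtain ⟨e, he, h⟩ := U.directed c hc d hd
  exact ⟨e, he, fun p hp => h p.1 p.2 hp⟩

lemma exists_ent_avoiding_finset {c : Fin U.n → M} (hc : c ∈ U.dom) (x : M) (F : Finset M) :
    ∃ e ∈ U.dom, U.ent e ⊆ U.ent c ∧ ∀ y ∈ F, y ≠ x → (x, y) ∉ U.ent e := by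
  classical
  induction F using Finset.induction_on with
  | empty => exact ⟨c, hc, subset_rfl, by simp⟩
  | insert z F _ ih =>
    obtain ⟨e, he, hec, heF⟩ := ih
    by_cases hz : z = x
    · refine ⟨e, he, hec, fun y hy hyx => ?_⟩
      rcases Finset.mem_insert.1 hy with rfl | hy
      · exact absurd hz hyx
      · exact heF y hy hyx
    · have : ∃ d ∈ U.dom, (x, z) ∉ U.ent d := by
        by_contra! hcon
        exact hz ((U.inter_eq_diag x z).1 hcon).symm
      obtain ⟨d, hd, hdz⟩ := this
      obtain ⟨f, hf, hfed⟩ := U.exists_ent_subset_inter he hd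
      refine ⟨f, hf, fun p hp => hec (hfed hp).1, fun y hy hyx hp => ?_⟩
      rcases Finset.mem_insert.1 hy with rfl | hy
      · exact hdz (hfed hp).2
      · exact heF y hy hyx (hfed hp).1

lemma definable_ballk_subset {k : ℕ} {A : Set (Fin (k + 1) → M)} (hA : DefSet L M A) :
    DefSet L M {w : Fin U.n ⊕ Fin (k + 1) → M | w ∘ Sum.inl ∈ U.dom ∧
      U.ballk (w ∘ Sum.inl) (Fin.tail (w ∘ Sum.inr)) ⊆
        {y | (Fin.cons (w (Sum.inr 0)) y : Fin (k + 1) → M) ∈ A}} := by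
  refine (U.dom_def.reindex Sum.inl).and ?_
  refine DefSet.forall_tuple (P := fun w y => y ∈ U.ballk (w ∘ Sum.inl) (Fin.tail (w ∘ Sum.inr)) →
    (Fin.cons (w (Sum.inr 0)) y : Fin (k + 1) → M) ∈ A) (DefSet.imp ?_ ?_)
  · refine DefSet.forall_finite fun i => ?_
    have h := U.phi_def.reindex
      (Sum.elim ![Sum.inl (Sum.inr i.succ), Sum.inr i] (Sum.inl ∘ Sum.inl) :
        Fin 2 ⊕ Fin U.n → (Fin U.n ⊕ Fin (k + 1)) ⊕ Fin k)
    convert h using 3 with w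
    simp only [Sum.comp_elim, ent, Set.mem_ofPred_eq]
    refine iff_of_eq (congrArg (· ∈ U.phi) ?_)
    congr 1
    ext j
    fin_cases j <;> rfl
  · have h := hA.reindex (Fin.cons (Sum.inl (Sum.inr 0)) Sum.inr :
      Fin (k + 1) → (Fin U.n ⊕ Fin (k + 1)) ⊕ Fin k)
    simpa only [Fin.comp_cons, Function.comp_apply] using h

end DefUniformBasis

namespace Setting

variable (S : Setting L M)

lemma ball_infinite {c : Fin S.n → M} (hc : c ∈ S.dom) (x : M) : (S.ball c x).Infinite := by
  intro hfin
  obtain ⟨e, he, hec, hF⟩ := S.exists_ent_avoiding_finset hc x hfin.toFinset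
  obtain ⟨y, hyx, hy⟩ := S.noIsolated x e he
  exact hF y (hfin.mem_toFinset.2 (hec hy)) hyx hy

lemma hasGrid_ballk {c : Fin S.n → M} (hc : c ∈ S.dom) (n : ℕ) {k : ℕ} (x : Fin k → M) :
    HasGrid n (S.ballk c x) := by
  induction k with
  | zero => exact ⟨x, S.mem_ballk_self hc x⟩
  | succ k ih =>
    let e := (S.ball_infinite hc (x 0)).natEmbedding
    refine ⟨fun j => e j, fun i j hij => ?_, (ih (Fin.tail x)).mono le_rfl fun a ha j => ?_⟩
    · exact Fin.ext (e.injective (Subtype.ext hij))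
    · refine Fin.cases ?_ (fun i => ?_)
      · exact (e j).2
      · exact ha i

/-- A definable set containing arbitrarily large finite grids has nonempty interior. -/
theorem interiork_nonempty_of_hasGrid {k : ℕ} {A : Set (Fin k → M)} (hA : DefSet L M A)
    (h : ∀ n, HasGrid n A) : (S.interiork A).Nonempty := by
  induction k with
  | zero =>
    obtain ⟨a, ha⟩ := h 0
    obtain ⟨c, hc⟩ := S.dom_nonempty
    exact ⟨a, c, hc, fun b _ => by rwa [Subsingleton.elim b a]⟩
  | succ k ih =>
    let W : (Fin S.n → M) → (Fin (k + 1) → M) → Prop := fun c p =>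
      c ∈ S.dom ∧ S.ballk c (Fin.tail p) ⊆ {y | (Fin.cons (p 0) y : Fin (k + 1) → M) ∈ A}
    have hW : DefSet L M {w : Fin S.n ⊕ Fin (k + 1) → M | W (w ∘ Sum.inl) (w ∘ Sum.inr)} :=
      S.definable_ballk_subset hA
    have hW' : DefSet L M {p | ∃ c, W c p} :=
      DefSet.exists_tuple (hW.reindex Sum.swap)
    have hlarge : ∀ n, HasGrid n {p | ∃ c, W c p} := by
      rcases hasGrid_or_hasGrid_of_subset_union (B := {p | ∃ c, W c p})
        (C := {p | p ∈ A ∧ ¬ ∃ c, W c p})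
        (fun p hp => (em (∃ c, W c p)).imp id fun hn => ⟨hp, hn⟩) h with h' | h'
      · exact h'
      exfalso
      have hdef : DefSet L M {p | p ∈ A ∧ ¬ ∃ c, W c p} := DefSet.and hA hW'.not
      obtain ⟨b, hb⟩ := S.saturated.exists_forall_hasGrid (l := 1) (k := k)
        (P := fun u a => (Fin.cons (u 0) a : Fin (k + 1) → M) ∈ {p | p ∈ A ∧ ¬ ∃ c, W c p})
        (by
          have h := hdef.reindex (Fin.cons (Sum.inl 0) Sum.inr : Fin (k + 1) → Fin 1 ⊕ Fin k)
          simpa only [Fin.comp_cons, Function.comp_apply] using h)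
        (fun n => by
          obtain ⟨s, -, hs⟩ := h' (n + 1)
          exact ⟨fun _ => s 0, hs.mono n.le_succ fun a ha => ha 0⟩)
      obtain ⟨a, c, hc, hac⟩ := ih (A := {a | (Fin.cons (b 0) a : Fin (k + 1) → M) ∈
          {p | p ∈ A ∧ ¬ ∃ c, W c p}})
        (hdef.subst (t := fun i v => (Fin.cons (b 0) v : Fin (k + 1) → M) i)
          (fun i => by
            refine Fin.cases ?_ (fun i => ?_) i
            · exact isCoordOrConst_const _
            · exact isCoordOrConst_coord i)) hb
      exact (hac (S.mem_ballk_self hc a)).2 ⟨c, hc, fun y hy => (hac hy).1⟩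
    obtain ⟨c, hc⟩ := S.saturated.exists_forall_hasGrid_of_directed hW
      (fun c d => by
        by_cases hc : c ∈ S.dom
        · by_cases hd : d ∈ S.dom
          · obtain ⟨e, he, hecd⟩ := S.exists_ent_subset_inter hc hd
            refine ⟨e, ?_⟩
            rintro p (hp | hp)
            · exact ⟨he, fun y hy => hp.2 fun i => (hecd (hy i)).1⟩
            · exact ⟨he, fun y hy => hp.2 fun i => (hecd (hy i)).2⟩
          · exact ⟨c, fun p hp => hp.resolve_right fun hp => hd hp.1⟩
        · exact ⟨d, fun p hp => hp.resolve_left fun hp => hc hp.1⟩) hlarge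
    have hcons : DefSet L M {w : Fin k ⊕ Fin 1 → M |
        W c (Fin.cons (w (Sum.inr 0)) (w ∘ Sum.inl))} := by
      have h := hW.subst (α := Fin k ⊕ Fin 1)
        (t := fun i w => (Sum.elim c (Fin.cons (w (Sum.inr 0)) (w ∘ Sum.inl)) :
          Fin S.n ⊕ Fin (k + 1) → M) i)
        (fun i => by
          rcases i with i | i
          · exact isCoordOrConst_const _
          · refine Fin.cases ?_ (fun i => ?_) i
            · exact isCoordOrConst_coord _
            · exact isCoordOrConst_coord (Sum.inl i))
      exact h
    obtain ⟨a, ha⟩ := S.saturated.exists_forall_hasGrid (l := k) (k := 1)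
      (P := fun a u => W c (Fin.cons (u 0) a)) hcons
      (fun n => by
        obtain ⟨s, hs, hg⟩ := hc (n + 1)
        obtain ⟨a, ha⟩ := hg.nonempty n.succ_pos
        exact ⟨a, s ∘ Fin.castLE n.le_succ, hs.comp (Fin.castLE_injective _),
          Fin.elim0, fun j => ha _⟩)
    have hcdom : c ∈ S.dom := by
      obtain ⟨u, hu⟩ := (ha 1).nonempty one_pos
      exact hu.1
    obtain ⟨b, e, he, hb⟩ := S.infInterior {b | W c (Fin.cons b a)}
      (hcons.subst (t := fun i u => (Sum.elim a u : Fin k ⊕ Fin 1 → M) i)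
        (fun i => by
          rcases i with i | i
          · exact isCoordOrConst_const _
          · exact isCoordOrConst_coord i))
      (infinite_of_hasGrid_one ha)
    obtain ⟨f, hf, hfec⟩ := S.exists_ent_subset_inter he hcdom
    refine ⟨Fin.cons b a, f, hf, fun y hy => ?_⟩
    have hy0 : W c (Fin.cons (y 0) a) := hb (hfec (hy 0)).1
    have := hy0.2 (show Fin.tail y ∈ S.ballk c a from fun i => (hfec (hy i.succ)).2)
    simpa using this

end Setting

/-- If a directed definable family of subsets of `M^k` has union with nonempty
interior, then some member of the family has nonempty interior. -/
theorem statement18 (S : Setting L M) {l k : ℕ} (Cf : Set ((Fin l → M) × (Fin k → M)))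
    (hdef : DefRel L M Cf)
    (hdir : ∀ x y : Fin l → M, ∃ z : Fin l → M,
      {p | (x, p) ∈ Cf} ∪ {p | (y, p) ∈ Cf} ⊆ {p | (z, p) ∈ Cf})
    (hint : (S.toDefUniformBasis.interiork {p : Fin k → M | ∃ x, (x, p) ∈ Cf}).Nonempty) :
    ∃ x : Fin l → M, (S.toDefUniformBasis.interiork {p : Fin k → M | (x, p) ∈ Cf}).Nonempty := by
  have hP : DefSet L M {w : Fin l ⊕ Fin k → M | (w ∘ Sum.inl, w ∘ Sum.inr) ∈ Cf} := hdef
  obtain ⟨x₀, c, hc, hx₀⟩ := hint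
  obtain ⟨x, hx⟩ := S.saturated.exists_forall_hasGrid_of_directed
    (P := fun x p => (x, p) ∈ Cf) hP
    (fun x y => by
      obtain ⟨z, hz⟩ := hdir x y
      exact ⟨z, fun p hp => hz hp⟩)
    (fun n => (S.hasGrid_ballk hc n x₀).mono le_rfl hx₀)
  exact ⟨x, S.interiork_nonempty_of_hasGrid
    (hP.subst (t := fun i v => (Sum.elim x v : Fin l ⊕ Fin k → M) i)
      (fun i => by
        rcases i with i | i
        · exact isCoordOrConst_const _
        · exact isCoordOrConst_coord i)) hx⟩

end DpTame
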